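/- arXiv:1509.04199 — 2 statements merged into one kernel-verified Lean document; each statement's English description precedes it below -/
import Mathlib

section
/- In the game i-Mark([1,2],{2}), for every n = 3q + r with q ≥ 6 and r ∈ {0,1,2}: if r = 1 then g(n) = 0; if r = 2 then g(n) = 1; and if r = 0 then g(n) ∈ {2,3}. Hence the Sprague-Grundy sequence is 1-almost periodic with preperiod 18, period 3, and exception set {0}. -/
/-- The minimum excludant of a finite set of naturals. -/
noncomputable def mex (s : Finset ℕ) : ℕ := sInf {k : ℕ | k ∉ s}

/-- Options of the game i-Mark(S,D) from a heap of `n` tokens: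
move to `n - s` for `s ∈ S` (with `1 ≤ s ≤ n`), or to `n / d` for `d ∈ D`
(with `2 ≤ d` and `d ∣ n`, `n ≥ 1`). -/
def iMarkOptions (S D : Finset ℕ) (n : ℕ) : Finset ℕ :=
  ((S.filter (fun s => 1 ≤ s ∧ s ≤ n)).image (fun s => n - s)) ∪
  ((D.filter (fun d => 2 ≤ d ∧ d ∣ n ∧ 1 ≤ n)).image (fun d => n / d))

theorem iMarkOptions_lt {S D : Finset ℕ} {n m : ℕ} (h : m ∈ iMarkOptions S D n) : m < n := by
  simp only [iMarkOptions, Finset.mem_union, Finset.mem_image, Finset.mem_filter] at h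
  rcases h with ⟨s, ⟨_, h1, h2⟩, rfl⟩ | ⟨d, ⟨_, h2, hd, hn⟩, rfl⟩
  · omega
  · exact Nat.div_lt_self hn h2

/-- The Sprague-Grundy value of a heap of `n` tokens in the game i-Mark(S,D). -/
noncomputable def grundy (S D : Finset ℕ) (n : ℕ) : ℕ :=
  mex ((iMarkOptions S D n).attach.image (fun m => grundy S D m.1))
termination_by n
decreasing_by exact iMarkOptions_lt m.2

/-- `misereP S D n` means `n` is a P-position of i-Mark(S,D) under misère convention:
`n` has at least one option and every option is an N-position. -/
def misereP (S D : Finset ℕ) (n : ℕ) : Prop :=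
  (iMarkOptions S D n).Nonempty ∧
    ∀ m : {x // x ∈ iMarkOptions S D n}, ¬ misereP S D m.1
termination_by n
decreasing_by exact iMarkOptions_lt m.2

theorem mex_eq_of_notMem_of_forall_lt_mem {s : Finset ℕ} {k : ℕ} (hk : k ∉ s)
    (h : ∀ j < k, j ∈ s) : mex s = k :=
  le_antisymm (Nat.sInf_le hk)
    (le_csInf ⟨k, hk⟩ fun j hj => not_lt.1 fun hlt => hj (h j hlt))

theorem grundy_eq_mex_image (S D : Finset ℕ) (n : ℕ) :
    grundy S D n = mex ((iMarkOptions S D n).image (grundy S D)) := by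
  rw [grundy]
  congr 1
  ext k
  simp

/-- A Grundy value is determined by not being attained by an option while all smaller values are. -/
theorem grundy_eq_of_options {S D : Finset ℕ} {n k : ℕ}
    (hk : ∀ m ∈ iMarkOptions S D n, grundy S D m ≠ k)
    (h : ∀ j < k, ∃ m ∈ iMarkOptions S D n, grundy S D m = j) : grundy S D n = k := by
  rw [grundy_eq_mex_image]
  apply mex_eq_of_notMem_of_forall_lt_mem
  · simpa using hk
  · simpa using h

theorem mem_iMarkOptions_12_2 {n m : ℕ} :
    m ∈ iMarkOptions {1, 2} {2} n ↔ m + 1 = n ∨ m + 2 = n ∨ (2 * m = n ∧ 1 ≤ n) := by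
  simp only [iMarkOptions, Finset.mem_union, Finset.mem_image, Finset.mem_filter,
    Finset.mem_insert, Finset.mem_singleton]
  constructor
  · rintro (⟨s, ⟨rfl | rfl, h1, h2⟩, rfl⟩ | ⟨d, ⟨rfl, -, hd, hn⟩, rfl⟩) <;> omega
  · rintro (rfl | rfl | ⟨rfl, h⟩)
    · exact Or.inl ⟨1, by omega, by omega⟩
    · exact Or.inl ⟨2, by omega, by omega⟩
    · exact Or.inr ⟨2, ⟨rfl, le_rfl, dvd_mul_right 2 m, h⟩, by omega⟩

theorem grundy_12_2_eq {n k : ℕ}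
    (hk : ∀ m, m + 1 = n ∨ m + 2 = n ∨ (2 * m = n ∧ 1 ≤ n) → grundy {1, 2} {2} m ≠ k)
    (h : ∀ j < k, ∃ m, (m + 1 = n ∨ m + 2 = n ∨ (2 * m = n ∧ 1 ≤ n)) ∧
      grundy {1, 2} {2} m = j) : grundy {1, 2} {2} n = k :=
  grundy_eq_of_options (fun m hm => hk m (mem_iMarkOptions_12_2.1 hm)) fun j hj =>
    let ⟨m, hm, hg⟩ := h j hj
    ⟨m, mem_iMarkOptions_12_2.2 hm, hg⟩

theorem grundy_12_2_of_odd {q a b k : ℕ} (ha : grundy {1, 2} {2} (2 * q + 1) = a)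
    (hb : grundy {1, 2} {2} (2 * q + 2) = b) (hk : k ≠ a ∧ k ≠ b)
    (h : ∀ j < k, j = a ∨ j = b) : grundy {1, 2} {2} (2 * q + 3) = k := by
  apply grundy_12_2_eq
  · intro m hm
    obtain rfl | rfl : m = 2 * q + 1 ∨ m = 2 * q + 2 := by omega
    · exact ha.trans_ne hk.1.symm
    · exact hb.trans_ne hk.2.symm
  · intro j hj
    obtain rfl | rfl := h j hj
    · exact ⟨2 * q + 1, by omega, ha⟩
    · exact ⟨2 * q + 2, by omega, hb⟩

theorem grundy_12_2_of_even {q a b c k : ℕ} (ha : grundy {1, 2} {2} (2 * q) = a)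
    (hb : grundy {1, 2} {2} (2 * q + 1) = b) (hc : grundy {1, 2} {2} (q + 1) = c)
    (hk : k ≠ a ∧ k ≠ b ∧ k ≠ c) (h : ∀ j < k, j = a ∨ j = b ∨ j = c) :
    grundy {1, 2} {2} (2 * q + 2) = k := by
  apply grundy_12_2_eq
  · intro m hm
    obtain rfl | rfl | rfl : m = 2 * q ∨ m = 2 * q + 1 ∨ m = q + 1 := by omega
    · exact ha.trans_ne hk.1.symm
    · exact hb.trans_ne hk.2.1.symm
    · exact hc.trans_ne hk.2.2.symm
  · intro j hj
    obtain rfl | rfl | rfl := h j hj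
    · exact ⟨2 * q, by omega, ha⟩
    · exact ⟨2 * q + 1, by omega, hb⟩
    · exact ⟨q + 1, by omega, hc⟩

/-- The values needed to start the induction, on the heaps from 9 to 17. -/
theorem grundy_12_2_initial :
    grundy {1, 2} {2} 9 = 1 ∧ grundy {1, 2} {2} 10 = 0 ∧ grundy {1, 2} {2} 11 = 2 ∧
    grundy {1, 2} {2} 13 = 0 ∧ grundy {1, 2} {2} 14 = 2 ∧
    grundy {1, 2} {2} 16 = 0 ∧ grundy {1, 2} {2} 17 = 2 := by
  have h0 : grundy {1, 2} {2} 0 = 0 := grundy_12_2_eq (by omega) (by omega)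
  have h1 : grundy {1, 2} {2} 1 = 1 := by
    apply grundy_12_2_eq
    · intro m hm
      obtain rfl : m = 0 := by omega
      omega
    · intro j hj
      exact ⟨0, by omega, by omega⟩
  have h2 : grundy {1, 2} {2} 2 = 2 :=
    grundy_12_2_of_even (q := 0) h0 h1 h1 (by omega) (by omega)
  have h3 : grundy {1, 2} {2} 3 = 0 := grundy_12_2_of_odd (q := 0) h1 h2 (by omega) (by omega)
  have h4 : grundy {1, 2} {2} 4 = 1 :=
    grundy_12_2_of_even (q := 1) h2 h3 h2 (by omega) (by omega)
  have h5 : grundy {1, 2} {2} 5 = 2 := grundy_12_2_of_odd (q := 1) h3 h4 (by omega) (by omega)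
  have h6 : grundy {1, 2} {2} 6 = 3 :=
    grundy_12_2_of_even (q := 2) h4 h5 h3 (by omega) (by omega)
  have h7 : grundy {1, 2} {2} 7 = 0 := grundy_12_2_of_odd (q := 2) h5 h6 (by omega) (by omega)
  have h8 : grundy {1, 2} {2} 8 = 2 :=
    grundy_12_2_of_even (q := 3) h6 h7 h4 (by omega) (by omega)
  have h9 : grundy {1, 2} {2} 9 = 1 := grundy_12_2_of_odd (q := 3) h7 h8 (by omega) (by omega)
  have h10 : grundy {1, 2} {2} 10 = 0 :=
    grundy_12_2_of_even (q := 4) h8 h9 h5 (by omega) (by omega)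
  have h11 : grundy {1, 2} {2} 11 = 2 := grundy_12_2_of_odd (q := 4) h9 h10 (by omega) (by omega)
  have h12 : grundy {1, 2} {2} 12 = 1 :=
    grundy_12_2_of_even (q := 5) h10 h11 h6 (by omega) (by omega)
  have h13 : grundy {1, 2} {2} 13 = 0 := grundy_12_2_of_odd (q := 5) h11 h12 (by omega) (by omega)
  have h14 : grundy {1, 2} {2} 14 = 2 :=
    grundy_12_2_of_even (q := 6) h12 h13 h7 (by omega) (by omega)
  have h15 : grundy {1, 2} {2} 15 = 1 := grundy_12_2_of_odd (q := 6) h13 h14 (by omega) (by omega)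
  have h16 : grundy {1, 2} {2} 16 = 0 :=
    grundy_12_2_of_even (q := 7) h14 h15 h8 (by omega) (by omega)
  have h17 : grundy {1, 2} {2} 17 = 2 := grundy_12_2_of_odd (q := 7) h15 h16 (by omega) (by omega)
  exact ⟨h9, h10, h11, h13, h14, h16, h17⟩

theorem grundy_12_2_mod_three (n : ℕ) (hn : 18 ≤ n) :
    (n % 3 = 1 → grundy {1, 2} {2} n = 0) ∧ (n % 3 = 2 → grundy {1, 2} {2} n = 1) ∧
    (n % 3 = 0 → grundy {1, 2} {2} n = 2 ∨ grundy {1, 2} {2} n = 3) := by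
  obtain ⟨h9, h10, h11, h13, h14, h16, h17⟩ := grundy_12_2_initial
  induction n using Nat.strong_induction_on with
  | _ n ih =>
    obtain rfl | hn18 : n = 18 ∨ 19 ≤ n := by omega
    · have h18 : grundy {1, 2} {2} 18 = 3 :=
        grundy_12_2_of_even (q := 8) h16 h17 h9 (by omega) (by omega)
      exact ⟨by omega, by omega, fun _ => Or.inr h18⟩
    have ih1 := ih (n - 1) (by omega) (by omega)
    have ih2 : (n % 3 = 0 → grundy {1, 2} {2} (n - 2) = 0) ∧
        (n % 3 = 1 → grundy {1, 2} {2} (n - 2) ≠ 0) ∧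
        (n % 3 = 2 → grundy {1, 2} {2} (n - 2) = 2 ∨ grundy {1, 2} {2} (n - 2) = 3) := by
      obtain rfl | h : n = 19 ∨ 20 ≤ n := by omega
      · simp [h17]
      · have := ih (n - 2) (by omega) (by omega)
        omega
    have hhalf : (n / 2 % 3 = 1 → grundy {1, 2} {2} (n / 2) = 0) ∧
        (n / 2 % 3 = 2 → grundy {1, 2} {2} (n / 2) ≠ 0) := by
      obtain h | h : n / 2 < 18 ∨ 18 ≤ n / 2 := by omega
      · have : 9 ≤ n / 2 := by omega
        generalize n / 2 = m at *
        interval_cases m <;> omega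
      · have := ih (n / 2) (by omega) h
        omega
    obtain ⟨q, rfl | rfl⟩ : ∃ q, n = 2 * q + 2 ∨ n = 2 * q + 3 := ⟨(n - 2) / 2, by omega⟩
    · simp only [show 2 * q + 2 - 1 = 2 * q + 1 by omega, show 2 * q + 2 - 2 = 2 * q by omega,
        show (2 * q + 2) / 2 = q + 1 by omega] at ih1 ih2 hhalf
      have key := fun k => grundy_12_2_of_even (q := q) (k := k) rfl rfl rfl
      refine ⟨fun h => key 0 (by omega) (by omega), fun h => key 1 (by omega) (by omega),
        fun h => ?_⟩
      by_cases h2 : grundy {1, 2} {2} (q + 1) = 2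
      · exact Or.inr (key 3 (by omega) (by omega))
      · exact Or.inl (key 2 (by omega) (by omega))
    · simp only [show 2 * q + 3 - 1 = 2 * q + 2 by omega,
        show 2 * q + 3 - 2 = 2 * q + 1 by omega] at ih1 ih2
      have key := fun k => grundy_12_2_of_odd (q := q) (k := k) rfl rfl
      exact ⟨fun h => key 0 (by omega) (by omega), fun h => key 1 (by omega) (by omega),
        fun h => Or.inl (key 2 (by omega) (by omega))⟩

/-- Sprague-Grundy values of i-Mark([1,2],{2}): values for n = 3q+r, q ≥ 6, and
1-almost periodicity with preperiod 18, period 3 and exception set {0}. -/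
theorem iMark_12_2_grundy :
    (∀ q r : ℕ, 6 ≤ q → r < 3 →
      ((r = 1 → grundy {1, 2} {2} (3 * q + r) = 0) ∧
       (r = 2 → grundy {1, 2} {2} (3 * q + r) = 1) ∧
       (r = 0 → grundy {1, 2} {2} (3 * q + r) = 2 ∨ grundy {1, 2} {2} (3 * q + r) = 3))) ∧
    (∀ n : ℕ, 18 ≤ n → n % 3 ≠ 0 → grundy {1, 2} {2} n = grundy {1, 2} {2} (n + 3)) := by
  refine ⟨fun q r hq hr => ?_, fun n hn h => ?_⟩
  · have := grundy_12_2_mod_three (3 * q + r) (by omega)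
    omega
  · have h1 := grundy_12_2_mod_three n hn
    have h2 := grundy_12_2_mod_three (n + 3) (by omega)
    omega
end

section
/- Let a ≥ 1 be odd, or a = 2. Then the outcome sequence of the misère game i-MiMark({a,2a},{2}) is purely periodic with period 3a: for every n ≥ 0, the positions n and n + 3a have the same outcome. -/
/-- The recurrence characterising the misère P-positions of i-Mark({a,2a},{2}). -/
theorem misereP_iff {a : ℕ} (ha : 1 ≤ a) (n : ℕ) :
    misereP {a, 2 * a} {2} n ↔
      (a ≤ n ∨ (2 ∣ n ∧ 1 ≤ n)) ∧ (a ≤ n → ¬ misereP {a, 2 * a} {2} (n - a)) ∧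
      (2 * a ≤ n → ¬ misereP {a, 2 * a} {2} (n - 2 * a)) ∧
      (2 ∣ n → 1 ≤ n → ¬ misereP {a, 2 * a} {2} (n / 2)) := by
  have hmem : ∀ m, m ∈ iMarkOptions {a, 2 * a} {2} n ↔
      (a ≤ n ∧ m = n - a) ∨ (2 * a ≤ n ∧ m = n - 2 * a) ∨ (2 ∣ n ∧ 1 ≤ n ∧ m = n / 2) := by
    intro m
    simp only [iMarkOptions, Finset.mem_union, Finset.mem_image, Finset.mem_filter,
      Finset.mem_insert, Finset.mem_singleton]
    constructor
    · rintro (⟨s, ⟨rfl | rfl, h1, h2⟩, rfl⟩ | ⟨d, ⟨rfl, h2, hd, hn⟩, rfl⟩)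
      · exact Or.inl ⟨h2, rfl⟩
      · exact Or.inr (Or.inl ⟨h2, rfl⟩)
      · exact Or.inr (Or.inr ⟨hd, hn, rfl⟩)
    · rintro (⟨h, rfl⟩ | ⟨h, rfl⟩ | ⟨hd, hn, rfl⟩)
      · exact Or.inl ⟨a, ⟨Or.inl rfl, ha, h⟩, rfl⟩
      · exact Or.inl ⟨2 * a, ⟨Or.inr rfl, by omega, h⟩, rfl⟩
      · exact Or.inr ⟨2, ⟨rfl, le_rfl, hd, hn⟩, rfl⟩
  rw [misereP, Subtype.forall]
  refine and_congr ⟨?_, ?_⟩ ⟨?_, ?_⟩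
  · rintro ⟨m, hm⟩
    rcases (hmem m).1 hm with h | h | h
    · exact Or.inl h.1
    · exact Or.inl (by omega)
    · exact Or.inr ⟨h.1, h.2.1⟩
  · rintro (h | h)
    · exact ⟨_, (hmem _).2 (Or.inl ⟨h, rfl⟩)⟩
    · exact ⟨_, (hmem _).2 (Or.inr (Or.inr ⟨h.1, h.2, rfl⟩))⟩
  · intro H
    exact ⟨fun h => H _ ((hmem _).2 (Or.inl ⟨h, rfl⟩)),
      fun h => H _ ((hmem _).2 (Or.inr (Or.inl ⟨h, rfl⟩))),
      fun h h' => H _ ((hmem _).2 (Or.inr (Or.inr ⟨h, h', rfl⟩)))⟩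
  · rintro ⟨h1, h2, h3⟩ m hm
    rcases (hmem m).1 hm with ⟨h, rfl⟩ | ⟨h, rfl⟩ | ⟨h, h', rfl⟩
    · exact h1 h
    · exact h2 h
    · exact h3 h h'

/-- A predicate satisfying the recurrence of the misère P-positions describes them. -/
theorem misereP_iff_of_recurrence {a : ℕ} (ha : 1 ≤ a) {T : ℕ → Prop}
    (hT : ∀ n, T n ↔ (a ≤ n ∨ (2 ∣ n ∧ 1 ≤ n)) ∧ (a ≤ n → ¬ T (n - a)) ∧
      (2 * a ≤ n → ¬ T (n - 2 * a)) ∧ (2 ∣ n → 1 ≤ n → ¬ T (n / 2))) (n : ℕ) :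
    misereP {a, 2 * a} {2} n ↔ T n := by
  induction n using Nat.strong_induction_on with
  | _ n ih =>
    rw [misereP_iff ha, hT]
    refine and_congr_right fun _ => and_congr ?_ (and_congr ?_ ?_)
    · exact forall_congr' fun h => not_congr (ih _ (by omega))
    · exact forall_congr' fun h => not_congr (ih _ (by omega))
    · exact forall_congr' fun _ => forall_congr' fun h => not_congr (ih _ (by omega))

/-- The exponent of `2` in `m` is odd. -/
def OddTwoVal (m : ℕ) : Prop := Odd (padicValNat 2 m)

theorem oddTwoVal_two_mul {m : ℕ} (hm : m ≠ 0) : OddTwoVal (2 * m) ↔ ¬ OddTwoVal m := by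
  rw [OddTwoVal, OddTwoVal, padicValNat.mul two_ne_zero hm, padicValNat.self one_lt_two,
    add_comm, Nat.odd_add_one]

theorem not_oddTwoVal_of_odd {m : ℕ} (hm : m % 2 = 1) : ¬ OddTwoVal m := by
  rw [OddTwoVal, padicValNat.eq_zero_of_not_dvd (by omega)]
  decide

theorem not_oddTwoVal_zero : ¬ OddTwoVal 0 := by
  simp [OddTwoVal]

/-- The P-positions of misère i-Mark({a,2a},{2}) for odd `a`, described by their residue
modulo `3 * a`. -/
def PPattern (a n : ℕ) : Prop :=
  (n % (3 * a) < a ∧ OddTwoVal (n % (3 * a))) ∨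
  (a ≤ n % (3 * a) ∧ n % (3 * a) < 2 * a ∧
    ((n % (3 * a) - a) % 2 = 0 ∧ ¬ OddTwoVal (n % (3 * a) - a) ∨
      (n % (3 * a) - a) % 2 = 1 ∧ OddTwoVal (n % (3 * a)))) ∨
  (2 * a ≤ n % (3 * a) ∧ (n % (3 * a)) % 2 = 1 ∧ ¬ OddTwoVal (n % (3 * a) - a))

theorem pPattern_add_mul (a n k : ℕ) : PPattern a (n + 3 * a * k) ↔ PPattern a n := by
  simp only [PPattern, Nat.add_mul_mod_self_left]

theorem pPattern_add (a n : ℕ) : PPattern a (n + 3 * a) ↔ PPattern a n := by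
  simpa using pPattern_add_mul a n 1

theorem pPattern_of_lt {a r : ℕ} (hr : r < a) : PPattern a r ↔ OddTwoVal r := by
  rw [PPattern, Nat.mod_eq_of_lt (by omega)]
  constructor
  · rintro (h | h | h)
    · exact h.2
    · omega
    · omega
  · exact fun h => Or.inl ⟨hr, h⟩

theorem pPattern_add_self {a r : ℕ} (hr : r < a) :
    PPattern a (r + a) ↔ r % 2 = 0 ∧ ¬ OddTwoVal r ∨ r % 2 = 1 ∧ OddTwoVal (r + a) := by
  rw [PPattern, Nat.mod_eq_of_lt (by omega), Nat.add_sub_cancel]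
  constructor
  · rintro (h | h | h)
    · omega
    · exact h.2.2
    · omega
  · exact fun h => Or.inr (Or.inl ⟨by omega, by omega, h⟩)

theorem pPattern_add_two_mul {a r : ℕ} (hr : r < a) :
    PPattern a (r + 2 * a) ↔ r % 2 = 1 ∧ ¬ OddTwoVal (r + a) := by
  rw [PPattern, Nat.mod_eq_of_lt (by omega), show r + 2 * a - a = r + a by omega]
  constructor
  · rintro (h | h | h)
    · omega
    · omega
    · exact ⟨by omega, h.2.2⟩
  · exact fun h => Or.inr (Or.inr ⟨by omega, by omega, h.2⟩)

theorem exists_residue {a : ℕ} (ha : 1 ≤ a) (n : ℕ) :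
    ∃ r < a, ∃ k, n = r + 3 * a * k ∨ n = r + a + 3 * a * k ∨ n = r + 2 * a + 3 * a * k := by
  have h1 := Nat.mod_add_div n (3 * a)
  have h2 : n % (3 * a) < 3 * a := Nat.mod_lt _ (by omega)
  rcases lt_or_ge (n % (3 * a)) a with h | h
  · exact ⟨_, h, _, Or.inl h1.symm⟩
  rcases lt_or_ge (n % (3 * a)) (2 * a) with h' | h'
  · exact ⟨n % (3 * a) - a, by omega, n / (3 * a), by omega⟩
  · exact ⟨n % (3 * a) - 2 * a, by omega, n / (3 * a), by omega⟩

/-- Exactly one of `n`, `n + a`, `n + 2a` belongs to the pattern. -/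
theorem pPattern_exactly_one {a : ℕ} (ha : 1 ≤ a) (n : ℕ) :
    (PPattern a n ∨ PPattern a (n + a) ∨ PPattern a (n + 2 * a)) ∧
      ¬ (PPattern a n ∧ PPattern a (n + a)) ∧ ¬ (PPattern a n ∧ PPattern a (n + 2 * a)) ∧
      ¬ (PPattern a (n + a) ∧ PPattern a (n + 2 * a)) := by
  obtain ⟨r, hr, k, h⟩ := exists_residue ha n
  have e0 : PPattern a (r + 3 * a * k) ↔ _ :=
    (pPattern_add_mul a r k).trans (pPattern_of_lt hr)
  have e1 : PPattern a (r + a + 3 * a * k) ↔ _ :=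
    (pPattern_add_mul a _ k).trans (pPattern_add_self hr)
  have e2 : PPattern a (r + 2 * a + 3 * a * k) ↔ _ :=
    (pPattern_add_mul a _ k).trans (pPattern_add_two_mul hr)
  have e3 := pPattern_add a (r + 3 * a * k)
  have e4 := pPattern_add a (r + a + 3 * a * k)
  have hodd : r % 2 = 1 → ¬ OddTwoVal r := not_oddTwoVal_of_odd
  have hpar := Nat.mod_two_eq_zero_or_one r
  rcases h with rfl | rfl | rfl
  · rw [show r + 3 * a * k + a = r + a + 3 * a * k by ring,
      show r + 3 * a * k + 2 * a = r + 2 * a + 3 * a * k by ring]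
    grind
  · rw [show r + a + 3 * a * k + a = r + 2 * a + 3 * a * k by ring,
      show r + a + 3 * a * k + 2 * a = r + 3 * a * k + 3 * a by ring]
    grind
  · rw [show r + 2 * a + 3 * a * k + a = r + 3 * a * k + 3 * a by ring,
      show r + 2 * a + 3 * a * k + 2 * a = r + a + 3 * a * k + 3 * a by ring]
    grind

/-- The double of a member of the pattern is not in the pattern. -/
theorem not_pPattern_two_mul {a : ℕ} (ha : a % 2 = 1) {m : ℕ} (hm : PPattern a m) :
    ¬ PPattern a (2 * m) := by
  obtain ⟨r, hr, k, h⟩ := exists_residue (show 1 ≤ a by omega) m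
  have hodd : ∀ x, x % 2 = 1 → ¬ OddTwoVal x := fun _ => not_oddTwoVal_of_odd
  have hpar := Nat.mod_two_eq_zero_or_one r
  rcases h with rfl | rfl | rfl
  · rw [pPattern_add_mul, pPattern_of_lt hr] at hm
    have hr0 : r ≠ 0 := by
      rintro rfl
      exact not_oddTwoVal_zero hm
    have hd := oddTwoVal_two_mul hr0
    rw [show 2 * (r + 3 * a * k) = 2 * r + 3 * a * (2 * k) by ring, pPattern_add_mul]
    rcases lt_or_ge (2 * r) a with h | h
    · rw [pPattern_of_lt h]
      tauto
    · obtain ⟨s, hs⟩ := Nat.exists_eq_add_of_le' h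
      rw [hs] at hd ⊢
      rw [pPattern_add_self (by omega)]
      grind
  · rw [show 2 * (r + a + 3 * a * k) = 2 * r + 2 * a + 3 * a * (2 * k) by ring,
      pPattern_add_mul]
    rcases lt_or_ge (2 * r) a with h | h
    · rw [pPattern_add_two_mul h]
      omega
    · obtain ⟨s, hs⟩ := Nat.exists_eq_add_of_le' h
      rw [show 2 * r + 2 * a = s + 3 * a by omega, pPattern_add, pPattern_of_lt (by omega)]
      exact hodd s (by omega)
  · rw [pPattern_add_mul, pPattern_add_two_mul hr] at hm
    have hd := (oddTwoVal_two_mul (by omega)).2 (hodd r hm.1)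
    rw [show 2 * (r + 2 * a + 3 * a * k) = 2 * r + a + 3 * a * (2 * k + 1) by ring,
      pPattern_add_mul]
    rcases lt_or_ge (2 * r) a with h | h
    · rw [pPattern_add_self h]
      grind
    · obtain ⟨s, hs⟩ := Nat.exists_eq_add_of_le' h
      rw [hs] at hd
      rw [show 2 * r + a = s + 2 * a by omega, pPattern_add_two_mul (by omega)]
      exact fun H => H.2 hd

theorem pPattern_recurrence {a : ℕ} (ha : a % 2 = 1) (n : ℕ) :
    PPattern a n ↔ (a ≤ n ∨ (2 ∣ n ∧ 1 ≤ n)) ∧ (a ≤ n → ¬ PPattern a (n - a)) ∧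
      (2 * a ≤ n → ¬ PPattern a (n - 2 * a)) ∧ (2 ∣ n → 1 ≤ n → ¬ PPattern a (n / 2)) := by
  have hhalf : 2 ∣ n → PPattern a n → ¬ PPattern a (n / 2) := by
    rintro ⟨m, rfl⟩ hn hm
    rw [Nat.mul_div_cancel_left m two_pos] at hm
    exact not_pPattern_two_mul ha hm hn
  rcases lt_or_ge n a with h | h
  · rw [pPattern_of_lt h, pPattern_of_lt (show n / 2 < a by omega)]
    rcases Nat.even_or_odd' n with ⟨m, rfl | rfl⟩
    · rcases Nat.eq_zero_or_pos m with rfl | hm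
      · refine iff_of_false not_oddTwoVal_zero fun H => ?_
        have := H.1
        omega
      · rw [oddTwoVal_two_mul hm.ne', Nat.mul_div_cancel_left m two_pos]
        refine ⟨fun H => ⟨Or.inr ⟨⟨m, rfl⟩, by omega⟩, by omega, by omega, fun _ _ => H⟩,
          fun H => H.2.2.2 ⟨m, rfl⟩ (by omega)⟩
    · refine iff_of_false (not_oddTwoVal_of_odd (by omega)) fun H => ?_
      have := H.1
      omega
  rcases lt_or_ge n (2 * a) with h' | h'
  · obtain ⟨r, rfl⟩ := Nat.exists_eq_add_of_le' h
    have hr : r < a := by omega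
    have hone := (pPattern_exactly_one (show 1 ≤ a by omega) r).2.1
    rw [Nat.add_sub_cancel]
    refine ⟨fun H => ⟨Or.inl h, fun _ h0 => hone ⟨h0, H⟩, by omega, fun hd _ => hhalf hd H⟩,
      fun ⟨_, H1, _, H2⟩ => ?_⟩
    rw [pPattern_of_lt hr] at H1
    rw [pPattern_of_lt (show (r + a) / 2 < a by omega)] at H2
    rw [pPattern_add_self hr]
    rcases Nat.mod_two_eq_zero_or_one r with hp | hp
    · exact Or.inl ⟨hp, H1 h⟩
    · refine Or.inr ⟨hp, ?_⟩
      have hd : 2 * ((r + a) / 2) = r + a := by omega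
      rw [← hd, oddTwoVal_two_mul (by omega)]
      exact H2 (by omega) (by omega)
  · obtain ⟨m, rfl⟩ := Nat.exists_eq_add_of_le' h'
    have hone := pPattern_exactly_one (show 1 ≤ a by omega) m
    rw [Nat.add_sub_cancel, show m + 2 * a - a = m + a by omega]
    refine ⟨fun H => ⟨Or.inl h, fun _ h0 => hone.2.2.2 ⟨h0, H⟩, fun _ h0 => hone.2.2.1 ⟨h0, H⟩,
      fun hd _ => hhalf hd H⟩, fun ⟨_, H1, H2, _⟩ => ?_⟩
    exact (hone.1.resolve_left (H2 h')).resolve_left (H1 h)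

/-- The outcome sequence of the misère game i-MiMark({a,2a},{2}) is purely periodic
with period 3a, when a is odd or a = 2. -/
theorem iMiMark_a_2a_periodic (a : ℕ) (ha : (1 ≤ a ∧ Odd a) ∨ a = 2) :
    ∀ n : ℕ, (misereP {a, 2 * a} {2} n ↔ misereP {a, 2 * a} {2} (n + 3 * a)) := by
  intro n
  rcases ha with ⟨h1, hodd⟩ | rfl
  · have hrec := pPattern_recurrence (Nat.odd_iff.1 hodd)
    rw [misereP_iff_of_recurrence h1 hrec, misereP_iff_of_recurrence h1 hrec, pPattern_add]
  · have hrec : ∀ n : ℕ, (n % 6 = 2 ∨ n % 6 = 3) ↔ (2 ≤ n ∨ (2 ∣ n ∧ 1 ≤ n)) ∧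
        (2 ≤ n → ¬ ((n - 2) % 6 = 2 ∨ (n - 2) % 6 = 3)) ∧
        (2 * 2 ≤ n → ¬ ((n - 2 * 2) % 6 = 2 ∨ (n - 2 * 2) % 6 = 3)) ∧
        (2 ∣ n → 1 ≤ n → ¬ (n / 2 % 6 = 2 ∨ n / 2 % 6 = 3)) := by
      intro n
      omega
    have key := misereP_iff_of_recurrence one_le_two
      (T := fun n => n % 6 = 2 ∨ n % 6 = 3) hrec
    rw [key, key]
    omega
end
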